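/- Let q be a prime power. Every irreducible complex character of PGL_2(q) of degree q+1 is unisingular. -/

import Mathlib

open Module FDRep Matrix CategoryTheory

/-- A finite-dimensional complex representation of a group is *unisingular* if every group
element acts with `1` as an eigenvalue. -/
def FDRep.IsUnisingular {G : Type} [Monoid G] (V : FDRep ℂ G) : Prop :=
  ∀ g : G, Module.End.HasEigenvalue (V.ρ g) 1


/-- The projective general linear group: the quotient of `GL n R` by its center. -/
abbrev Matrix.ProjectiveGeneralLinearGroup (n : Type*) [DecidableEq n] [Fintype n]
    (R : Type*) [CommRing R] : Type _ :=
  GL n R ⧸ Subgroup.center (GL n R)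

/-- `PGL₂(F)`, the projective general linear group of degree 2 over `F`. -/
abbrev PGL2 (F : Type) [Field F] : Type _ :=
  Matrix.ProjectiveGeneralLinearGroup (Fin 2) F

section Trace

variable {V : Type*} [AddCommGroup V] [Module ℂ V]

theorem Module.End.pow_eq_one_of_hasEigenvalue {f : End ℂ V} {n : ℕ} (hf : f ^ n = 1) {μ : ℂ}
    (hμ : f.HasEigenvalue μ) : μ ^ n = 1 := by
  obtain ⟨v, hv⟩ := hμ.exists_hasEigenvector
  have h := hv.pow_apply n
  rw [hf, Module.End.one_apply] at h
  by_contra hne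
  have : (μ ^ n - 1) • v = 0 := by rw [sub_smul, ← h, one_smul, sub_self]
  rcases smul_eq_zero.1 this with h0 | h0
  · exact hne (sub_eq_zero.1 h0)
  · exact hv.2 h0

theorem LinearMap.isIntegral_trace_of_pow_eq_one [FiniteDimensional ℂ V] {f : End ℂ V} {n : ℕ} (hn : 0 < n)
    (hf : f ^ n = 1) : IsIntegral ℤ (LinearMap.trace ℂ V f) := by
  rw [Module.End.trace_eq_sum_roots_charpoly_of_splits (IsAlgClosed.splits _)]
  refine IsIntegral.multiset_sum fun μ hμ => ?_
  have hμ' : f.HasEigenvalue μ :=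
    (Module.End.hasEigenvalue_iff_isRoot_charpoly f μ).2 (Polynomial.isRoot_of_mem_roots hμ)
  exact IsIntegral.of_pow hn (by
    rw [Module.End.pow_eq_one_of_hasEigenvalue hf hμ']; exact isIntegral_one)

theorem Module.End.isSemisimple_of_pow_eq_one {f : End ℂ V} {n : ℕ} (hn : 0 < n)
    (hf : f ^ n = 1) : f.IsSemisimple := by
  refine Module.End.isSemisimple_of_squarefree_aeval_eq_zero (p := Polynomial.X ^ n - 1) ?_ ?_
  · exact ((Polynomial.separable_X_pow_sub_C (1 : ℂ) (by exact_mod_cast hn.ne')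
      one_ne_zero).squarefree)
  · simp [hf]

/-- The trace of the inverse of an operator of finite order is the complex conjugate. -/
theorem LinearMap.trace_eq_conj_of_pow_eq_one [FiniteDimensional ℂ V] {f g : End ℂ V} {n : ℕ} (hn : 0 < n)
    (hf : f ^ n = 1) (hgf : g * f = 1) :
    LinearMap.trace ℂ V g = starRingEnd ℂ (LinearMap.trace ℂ V f) := by
  classical
  have hint : DirectSum.IsInternal (fun μ : ℂ => f.eigenspace μ) :=
    DirectSum.isInternal_submodule_of_iSupIndep_of_iSup_eq_top
      f.eigenspaces_iSupIndep
      (Module.End.isSemisimple_of_pow_eq_one hn hf).iSup_eigenspace_eq_top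
  have hfin : {μ : ℂ | f.eigenspace μ ≠ ⊥}.Finite :=
    WellFoundedGT.finite_ne_bot_of_iSupIndep f.eigenspaces_iSupIndep
  have hgv : ∀ μ : ℂ, ∀ v ∈ f.eigenspace μ, g v = starRingEnd ℂ μ • v := by
    intro μ v hv
    rcases eq_or_ne v 0 with rfl | hv0
    · simp
    have hμ : μ ^ n = 1 := Module.End.pow_eq_one_of_hasEigenvalue hf
      (Module.End.hasEigenvalue_of_hasEigenvector ⟨hv, hv0⟩)
    have hμc : starRingEnd ℂ μ = μ⁻¹ :=
      (Complex.inv_eq_conj (Complex.norm_eq_one_of_pow_eq_one hμ hn.ne')).symm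
    have hμ0 : μ ≠ 0 := by rintro rfl; simp [hn.ne'] at hμ
    have h1 : g (f v) = v := by rw [← Module.End.mul_apply, hgf, Module.End.one_apply]
    rw [Module.End.mem_eigenspace_iff.1 hv, map_smul] at h1
    rw [hμc, eq_inv_smul_iff₀ hμ0, h1]
  have hfm : ∀ μ : ℂ, Set.MapsTo f (f.eigenspace μ) (f.eigenspace μ) := fun μ v hv => by
    rw [Module.End.mem_eigenspace_iff.1 hv]; exact Submodule.smul_mem _ _ hv
  have hgm : ∀ μ : ℂ, Set.MapsTo g (f.eigenspace μ) (f.eigenspace μ) := fun μ v hv => by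
    rw [hgv μ v hv]; exact Submodule.smul_mem _ _ hv
  rw [LinearMap.trace_eq_sum_trace_restrict' hint hfin hfm,
    LinearMap.trace_eq_sum_trace_restrict' hint hfin hgm, map_sum]
  refine Finset.sum_congr rfl fun μ _ => ?_
  have h1 : f.restrict (hfm μ) = μ • LinearMap.id := by
    ext v; exact Module.End.mem_eigenspace_iff.1 v.2
  have h2 : g.restrict (hgm μ) = starRingEnd ℂ μ • LinearMap.id := by
    ext v; exact hgv μ v v.2
  rw [h1, h2]
  simp

end Trace

/-- Simplicity of an object of `FDRep` gives irreducibility of the underlying representation. -/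
theorem FDRep.isIrreducible_of_simple {G : Type} [Group G] (V : FDRep ℂ G) [Simple V] :
    Representation.IsIrreducible (V.ρ : Representation ℂ G V) := by
  have hV : Nontrivial V := by
    by_contra hV
    rw [not_nontrivial_iff_subsingleton] at hV
    refine id_nonzero V ?_
    ext x
    exact Subsingleton.elim (α := V) _ _
  have key : ∀ W : Subrepresentation (V.ρ : Representation ℂ G V), W ≠ ⊥ → W = ⊤ := by
    intro W hW
    let i : FDRep.of W.toRepresentation ⟶ V :=
      ⟨FGModuleCat.ofHom W.toSubmodule.subtype, fun g => by ext x; rfl⟩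
    have : Mono i := ConcreteCategory.mono_of_injective i (by
      exact Subtype.val_injective)
    have hi : i ≠ 0 := by
      intro h0
      apply hW
      refine SetLike.ext fun x => ⟨fun hx => ?_, fun hx => ?_⟩
      · have : i.hom ⟨x, hx⟩ = (0 : FDRep.of W.toRepresentation ⟶ V).hom ⟨x, hx⟩ := by rw [h0]
        exact this
      · have : x = 0 := hx
        rw [this]
        exact W.toSubmodule.zero_mem
    have : IsIso i := isIso_of_mono_of_nonzero hi
    refine SetLike.ext fun x => ⟨fun _ => trivial, fun _ => ?_⟩
    obtain ⟨y, hy⟩ := (FDRep.isoToLinearEquiv (asIso i)).surjective x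
    have hy' : (y : V) = x := hy
    rw [← hy']
    exact y.2
  exact
    { exists_pair_ne := ⟨⊥, ⊤, fun h => by
        obtain ⟨x, hx⟩ := exists_ne (0 : V)
        have : x ∈ (⊤ : Subrepresentation (V.ρ : Representation ℂ G V)) := trivial
        rw [← h] at this
        exact hx this⟩
      eq_bot_or_eq_top := fun W => or_iff_not_imp_left.2 (key W) }

/-- Irreducibility only depends on the image of the representation. -/
theorem Representation.IsIrreducible.comp_surjective {G H V : Type*} [Group G] [Group H]
    [AddCommGroup V] [Module ℂ V] {ρ : Representation ℂ H V} (hρ : ρ.IsIrreducible)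
    {f : G →* H} (hf : Function.Surjective f) :
    Representation.IsIrreducible (ρ.comp f : Representation ℂ G V) := by
  have e : Subrepresentation (ρ.comp f : Representation ℂ G V) ≃o Subrepresentation ρ :=
    { toFun := fun W => ⟨W.toSubmodule, fun h v hv => by
        obtain ⟨g, rfl⟩ := hf h
        exact W.apply_mem_toSubmodule g hv⟩
      invFun := fun W => ⟨W.toSubmodule, fun g _ hv => W.apply_mem_toSubmodule (f g) hv⟩
      left_inv := fun _ => rfl
      right_inv := fun _ => rfl
      map_rel_iff' := Iff.rfl }
  exact e.isSimpleOrder_iff.2 hρ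

section Monomial

variable {G V : Type*} [Group G] [AddCommGroup V] [Module ℂ V] {ρ : Representation ℂ G V}

theorem Representation.IsIrreducible.eq_top {W : Submodule ℂ V} (hρ : ρ.IsIrreducible)
    (hW : ∀ g, ∀ v ∈ W, ρ g v ∈ W) (h0 : W ≠ ⊥) : W = ⊤ := by
  rcases hρ.eq_bot_or_eq_top ⟨W, hW⟩ with h | h
  · exact absurd (congrArg Subrepresentation.toSubmodule h) h0
  · exact congrArg Subrepresentation.toSubmodule h

/-- If `v` spans a line stable under `B` and the index of `B` is at most the dimension, then the
translates of `v` by coset representatives are linearly independent. -/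
theorem Representation.IsIrreducible.linearIndependent_translates [FiniteDimensional ℂ V]
    (hρ : ρ.IsIrreducible) {B : Subgroup G} [Fintype (G ⧸ B)] {v : V} (hv : v ≠ 0)
    (hB : ∀ b ∈ B, ∃ c : ℂ, ρ b v = c • v) (hcard : Fintype.card (G ⧸ B) ≤ finrank ℂ V) :
    LinearIndependent ℂ (fun x : G ⧸ B => ρ x.out v) := by
  have hmem : ∀ g : G, ρ g v ∈ Submodule.span ℂ (Set.range fun x : G ⧸ B => ρ x.out v) := by
    intro g
    obtain ⟨b, hb⟩ := QuotientGroup.mk_out_eq_mul B g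
    obtain ⟨c, hc⟩ := hB b⁻¹ (B.inv_mem b.2)
    have : ρ g v = c • ρ (g : G ⧸ B).out v := by
      rw [← map_smul, ← hc, ← Module.End.mul_apply, ← map_mul, hb]
      simp
    rw [this]
    exact Submodule.smul_mem _ _ (Submodule.subset_span ⟨_, rfl⟩)
  have htop : Submodule.span ℂ (Set.range fun x : G ⧸ B => ρ x.out v) = ⊤ := by
    refine hρ.eq_top (fun g w hw => ?_) fun h => hv ?_
    · induction hw using Submodule.span_induction with
      | mem w hw =>
        obtain ⟨x, rfl⟩ := hw
        have := hmem (g * x.out)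
        rwa [map_mul] at this
      | zero => simp
      | add x y _ _ hx hy => rw [map_add]; exact add_mem hx hy
      | smul c x _ hx => rw [map_smul]; exact Submodule.smul_mem _ _ hx
    · simpa [h] using hmem 1
  refine linearIndependent_of_top_le_span_of_card_eq_finrank htop.ge (le_antisymm hcard ?_)
  rw [← finrank_top ℂ V, ← htop]
  exact finrank_range_le_card _

/-- In the situation of `linearIndependent_translates`, an element having a regular orbit on the
cosets of `B` has a nonzero fixed vector. -/
theorem Representation.IsIrreducible.hasEigenvalue_one [Finite G] [FiniteDimensional ℂ V]
    (hρ : ρ.IsIrreducible) {B : Subgroup G} {v : V} (hv : v ≠ 0)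
    (hB : ∀ b ∈ B, ∃ c : ℂ, ρ b v = c • v) (hcard : Nat.card (G ⧸ B) ≤ finrank ℂ V)
    {g h : G} (hfree : ∀ k : ℕ, h⁻¹ * g ^ k * h ∈ B → ρ g ^ k = 1) :
    Module.End.HasEigenvalue (ρ g) 1 := by
  classical
  have := Fintype.ofFinite (G ⧸ B)
  rw [Nat.card_eq_fintype_card] at hcard
  have hli := hρ.linearIndependent_translates hv hB hcard
  have hfo : IsOfFinOrder (ρ g) := MonoidHom.isOfFinOrder ρ (isOfFinOrder_of_finite g)
  set n := orderOf (ρ g) with hn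
  have hn0 : 0 < n := hfo.orderOf_pos
  let p : Fin n → G ⧸ B := fun i => ((g ^ (i : ℕ) * h : G) : G ⧸ B)
  have hlt : ∀ i j : Fin n, i ≤ j → p i = p j → i = j := by
    intro i j hij hp
    have hmem := QuotientGroup.eq.1 hp
    have hk : (g ^ (i : ℕ) * h)⁻¹ * (g ^ (j : ℕ) * h) = h⁻¹ * g ^ ((j : ℕ) - i) * h := by
      rw [pow_sub _ hij]
      group
    rw [hk] at hmem
    have hd := orderOf_dvd_of_pow_eq_one (hfree _ hmem)
    have h0 : (j : ℕ) - i = 0 := Nat.eq_zero_of_dvd_of_lt hd (by rw [← hn]; omega)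
    have : (i : ℕ) ≤ j := hij
    exact Fin.ext (by omega)
  have hp : Function.Injective p := fun i j hij => by
    rcases le_total i j with h' | h'
    · exact hlt i j h' hij
    · exact (hlt j i h' hij.symm).symm
  have hc : ∀ x : G, ∃ c : ℂ, ρ x v = c • ρ (x : G ⧸ B).out v := by
    intro x
    obtain ⟨b, hb⟩ := QuotientGroup.mk_out_eq_mul B x
    obtain ⟨c, hc⟩ := hB b⁻¹ (B.inv_mem b.2)
    refine ⟨c, ?_⟩
    rw [← map_smul, ← hc, ← Module.End.mul_apply, ← map_mul, hb]
    simp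
  choose c hc using hc
  set s : V := ∑ i ∈ Finset.range n, (ρ g ^ i) (ρ h v) with hs
  have hfix : ρ g s = s := by
    have h1 : ρ g s = ∑ i ∈ Finset.range n, (ρ g ^ (i + 1)) (ρ h v) := by
      rw [hs, map_sum]
      exact Finset.sum_congr rfl fun i _ => by rw [pow_succ', Module.End.mul_apply]
    have h2 := Finset.sum_range_succ (fun i => (ρ g ^ i) (ρ h v)) n
    rw [Finset.sum_range_succ', ← h1, ← hs, hn, pow_orderOf_eq_one, pow_zero] at h2
    exact add_right_cancel h2
  have hs0 : s ≠ 0 := by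
    intro h0
    have hsum : ∑ i : Fin n, c (g ^ (i : ℕ) * h) • ρ (p i).out v = 0 := by
      rw [← h0, hs, Finset.sum_range]
      refine Finset.sum_congr rfl fun i _ => ?_
      rw [← hc, map_mul, map_pow, Module.End.mul_apply]
    have hz := Fintype.linearIndependent_iff.1 (hli.comp p hp) _ hsum ⟨0, hn0⟩
    have := hc (g ^ 0 * h)
    rw [show c (g ^ 0 * h) = 0 from hz, zero_smul] at this
    apply hv
    rw [← ρ.inv_self_apply (g ^ 0 * h) v, this, map_zero]
  exact Module.End.hasEigenvalue_of_hasEigenvector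
    ⟨Module.End.mem_eigenspace_iff.2 (by rw [hfix, one_smul]), hs0⟩

end Monomial

namespace GLTwo

variable {F : Type} [Field F]

/-- The upper triangular matrices in `GL₂(F)`. -/
def borel (F : Type) [Field F] : Subgroup (GL (Fin 2) F) where
  carrier := {g | g.1 1 0 = 0}
  one_mem' := by simp
  mul_mem' {a b} ha hb := by
    simp only [Set.mem_ofPred_eq] at ha hb ⊢
    simp [Matrix.mul_apply, Fin.sum_univ_two, ha, hb]
  inv_mem' {a} ha := by
    simp only [Set.mem_ofPred_eq] at ha ⊢
    rw [Matrix.coe_units_inv, Matrix.inv_def, Matrix.adjugate_fin_two]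
    simp [ha]

theorem mem_borel {g : GL (Fin 2) F} : g ∈ borel F ↔ g.1 1 0 = 0 := Iff.rfl

/-- The upper unitriangular matrix with entry `x`. -/
def upper (x : F) : GL (Fin 2) F :=
  ⟨!![1, x; 0, 1], !![1, -x; 0, 1], by simp [Matrix.one_fin_two], by simp [Matrix.one_fin_two]⟩

/-- The lower unitriangular matrix with entry `x`. -/
def lower (x : F) : GL (Fin 2) F :=
  ⟨!![1, 0; x, 1], !![1, 0; -x, 1], by simp [Matrix.one_fin_two], by simp [Matrix.one_fin_two]⟩

/-- The diagonal matrix with entries `a` and `1`. -/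
def diag (a : Fˣ) : GL (Fin 2) F :=
  ⟨!![(a : F), 0; 0, 1], !![((a⁻¹ : Fˣ) : F), 0; 0, 1], by simp [Matrix.one_fin_two],
    by simp [Matrix.one_fin_two]⟩

/-- The scalar matrix `z`. -/
def scal (z : Fˣ) : GL (Fin 2) F :=
  ⟨!![(z : F), 0; 0, z], !![((z⁻¹ : Fˣ) : F), 0; 0, ((z⁻¹ : Fˣ) : F)],
    by simp [Matrix.one_fin_two], by simp [Matrix.one_fin_two]⟩

/-- The permutation matrix of the transposition. -/
def swap (F : Type) [Field F] : GL (Fin 2) F :=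
  ⟨!![0, 1; 1, 0], !![0, 1; 1, 0], by simp [Matrix.one_fin_two], by simp [Matrix.one_fin_two]⟩

theorem upper_add (x y : F) : upper (x + y) = upper x * upper y := by
  ext i j; fin_cases i <;> fin_cases j <;> simp [upper, add_comm]

theorem upper_zero : upper (0 : F) = 1 := by
  ext i j; fin_cases i <;> fin_cases j <;> simp [upper]

theorem diag_mul (a b : Fˣ) : diag (a * b) = diag a * diag b := by
  ext i j; fin_cases i <;> fin_cases j <;> simp [diag]

theorem diag_one : diag (1 : Fˣ) = 1 := by
  ext i j; fin_cases i <;> fin_cases j <;> simp [diag]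

theorem diag_mul_upper (a : Fˣ) (x : F) : diag a * upper x = upper (a * x) * diag a := by
  ext i j; fin_cases i <;> fin_cases j <;> simp [diag, upper]

theorem swap_mul_upper (x : F) : swap F * upper x = lower x * swap F := by
  ext i j; fin_cases i <;> fin_cases j <;> simp [swap, upper, lower]

theorem scal_eq_scalar (z : Fˣ) : (scal z).1 = Matrix.scalar (Fin 2) (z : F) := by
  ext i j; fin_cases i <;> fin_cases j <;> simp [scal]

theorem scal_mem_center (z : Fˣ) : scal z ∈ Subgroup.center (GL (Fin 2) F) :=
  Matrix.GeneralLinearGroup.mem_center_iff_val_mem_range_scalar.2 ⟨z, (scal_eq_scalar z).symm⟩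

theorem eq_of_mem_borel {g : GL (Fin 2) F} (hg : g ∈ borel F) :
    ∃ (z a : Fˣ) (x : F), g = scal z * diag a * upper x := by
  rw [mem_borel] at hg
  have hdet : g.1 0 0 * g.1 1 1 ≠ 0 := by
    have := (Matrix.isUnit_iff_isUnit_det _).1 g.isUnit
    rw [Matrix.det_fin_two, hg, mul_zero, sub_zero] at this
    exact this.ne_zero
  have h0 := left_ne_zero_of_mul hdet
  have h1 := right_ne_zero_of_mul hdet
  refine ⟨Units.mk0 _ h1, Units.mk0 _ h0 * (Units.mk0 _ h1)⁻¹, g.1 0 1 / g.1 0 0, ?_⟩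
  ext i j
  fin_cases i <;> fin_cases j <;> simp [scal, diag, upper, hg] <;> field_simp

theorem card_quotient_borel_le [Fintype F] :
    Nat.card (GL (Fin 2) F ⧸ borel F) ≤ Fintype.card F + 1 := by
  let f : Option F → GL (Fin 2) F ⧸ borel F := fun o =>
    o.elim ((1 : GL (Fin 2) F) : GL (Fin 2) F ⧸ borel F) fun x =>
      ((upper x * swap F : GL (Fin 2) F) : GL (Fin 2) F ⧸ borel F)
  have hf : Function.Surjective f := by
    intro y
    induction y using QuotientGroup.induction_on with | _ g => ?_
    by_cases h : g.1 1 0 = 0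
    · refine ⟨none, QuotientGroup.eq.2 ?_⟩
      simpa using mem_borel.2 h
    · refine ⟨some (g.1 0 0 / g.1 1 0), QuotientGroup.eq.2 ?_⟩
      have hi : (upper (g.1 0 0 / g.1 1 0) * swap F)⁻¹ =
          swap F * upper (-(g.1 0 0 / g.1 1 0)) := by
        rw [inv_eq_iff_mul_eq_one]
        ext i j
        fin_cases i <;> fin_cases j <;> simp [swap, upper]
      rw [hi, mem_borel]
      simp [swap, upper, Matrix.mul_apply, Fin.sum_univ_two]
      field_simp
      simp
  have := Nat.card_le_card_of_surjective f hf
  simpa using this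

/-- A noncentral element of `GL₂(F)` has a point of the projective line on which it acts freely
modulo scalars. -/
theorem exists_free_point (g : GL (Fin 2) F) (hg : g ∉ Subgroup.center (GL (Fin 2) F)) :
    ∃ h : GL (Fin 2) F, ∀ k : ℕ, h⁻¹ * g ^ k * h ∈ borel F →
      g ^ k ∈ Subgroup.center (GL (Fin 2) F) := by
  have hx : ∃ x : Fin 2 → F, LinearIndependent F ![x, g.1 *ᵥ x] := by
    by_contra! hno
    obtain ⟨a, ha⟩ := LinearMap.exists_eq_smul_id_of_forall_notLinearIndependent
      (f := Matrix.toLin' g.1) (fun v => by simpa using hno v)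
    refine hg (Matrix.GeneralLinearGroup.mem_center_iff_val_mem_range_scalar.2 ⟨a, ?_⟩)
    apply Matrix.toLin'.injective
    rw [ha]
    ext i j
    simp [Pi.single_apply]
  obtain ⟨x, hx⟩ := hx
  let M : Matrix (Fin 2) (Fin 2) F := (Matrix.of ![x, g.1 *ᵥ x])ᵀ
  have hM : IsUnit M := by
    rw [Matrix.isUnit_transpose]
    exact Matrix.linearIndependent_rows_iff_isUnit.1 hx
  obtain ⟨h, hh⟩ := hM
  refine ⟨h, fun k hk => ?_⟩
  rw [mem_borel] at hk
  set b := h⁻¹ * g ^ k * h with hb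
  have hgb : g ^ k * h = h * b := by rw [hb]; group
  have hcol : (g ^ k).1 *ᵥ x = b.1 0 0 • x := by
    ext i
    have := congrArg (fun m : GL (Fin 2) F => m.1 i 0) hgb
    simp only [Units.val_mul, hh, Matrix.mul_apply, Fin.sum_univ_two, M, hk] at this
    simpa [Matrix.mulVec, dotProduct, Fin.sum_univ_two, mul_comm] using this
  have hcol' : (g ^ k).1 *ᵥ (g.1 *ᵥ x) = b.1 0 0 • (g.1 *ᵥ x) := by
    have hcomm : (g ^ k).1 * g.1 = g.1 * (g ^ k).1 :=
      congrArg Units.val (Commute.pow_self g k).eq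
    rw [Matrix.mulVec_mulVec, hcomm, ← Matrix.mulVec_mulVec, hcol, Matrix.mulVec_smul]
  have hmul : (g ^ k).1 * h.1 = (Matrix.scalar (Fin 2) (b.1 0 0)) * h.1 := by
    rw [hh]
    rw [Matrix.scalar_apply, ← Matrix.smul_one_eq_diagonal, Matrix.smul_mul, Matrix.one_mul]
    ext i j
    fin_cases j
    · simpa [M, Matrix.mul_apply, Matrix.mulVec, dotProduct] using congrFun hcol i
    · simpa [M, Matrix.mul_apply, Matrix.mulVec, dotProduct] using congrFun hcol' i
  exact Matrix.GeneralLinearGroup.mem_center_iff_val_mem_range_scalar.2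
    ⟨b.1 0 0, (h.isUnit.mul_right_cancel hmul).symm⟩

end GLTwo

namespace GLTwo

variable {F : Type} [Field F] {V : Type*} [AddCommGroup V] [Module ℂ V]
  {ρ : Representation ℂ (GL (Fin 2) F) V}

/-- If the upper unitriangular matrices have a nonzero common fixed vector, then the Borel subgroup
stabilizes a line. -/
theorem exists_borel_eigenvector [FiniteDimensional ℂ V] [Finite F] (hZ : ∀ z : Fˣ, ρ (scal z) = 1) {w : V} (hw : w ≠ 0)
    (hU : ∀ x, ρ (upper x) w = w) :
    ∃ v : V, v ≠ 0 ∧ ∀ b ∈ borel F, ∃ c : ℂ, ρ b v = c • v := by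
  let W : Submodule ℂ V := ⨅ x : F, Module.End.eigenspace (ρ (upper x)) 1
  have hW : ∀ {u : V}, u ∈ W ↔ ∀ x, ρ (upper x) u = u := by
    intro u
    simp [W, Submodule.mem_iInf]
  obtain ⟨a, ha⟩ := IsCyclic.exists_generator (α := Fˣ)
  have hmaps : ∀ u ∈ W, ρ (diag a) u ∈ W := by
    intro u hu
    rw [hW] at hu ⊢
    intro x
    have h1 : upper x * diag a = diag a * upper ((a⁻¹ : Fˣ) * x) := by
      rw [diag_mul_upper, Units.mul_inv_cancel_left]
    rw [← Module.End.mul_apply, ← map_mul, h1, map_mul, Module.End.mul_apply, hu]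
  have : Nontrivial W := ⟨⟨⟨w, hW.2 hU⟩, 0, fun h => hw (congrArg Subtype.val h)⟩⟩
  obtain ⟨μ, hμ⟩ := Module.End.exists_eigenvalue ((ρ (diag a)).restrict hmaps)
  obtain ⟨⟨v, hvW⟩, hv⟩ := hμ.exists_hasEigenvector
  have hv0 : v ≠ 0 := fun h => hv.2 (Subtype.ext h)
  have hva : ρ (diag a) v = μ • v := congrArg Subtype.val (Module.End.mem_eigenspace_iff.1 hv.1)
  have hdiag : ∀ b : Fˣ, ∃ c : ℂ, ρ (diag b) v = c • v := by
    intro b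
    obtain ⟨k, rfl⟩ := (mem_powers_iff_mem_zpowers (x := a)).2 (ha b)
    have hk : diag (a ^ k) = (diag a) ^ k := by
      induction k with
      | zero => simp [diag_one]
      | succ k ih => rw [pow_succ, pow_succ, diag_mul, ih]
    refine ⟨μ ^ k, ?_⟩
    change ρ (diag (a ^ k)) v = _
    rw [hk, map_pow]
    exact Module.End.HasEigenvector.pow_apply ⟨Module.End.mem_eigenspace_iff.2 hva, hv0⟩ k
  refine ⟨v, hv0, fun b hb => ?_⟩
  obtain ⟨z, d, x, rfl⟩ := eq_of_mem_borel hb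
  obtain ⟨c, hc⟩ := hdiag d
  exact ⟨c, by simp [hZ, hW.1 hvW x, hc]⟩

theorem character_upper_eq {x : F} (hx : x ≠ 0) :
    ρ.character (upper x) = ρ.character (upper 1) := by
  have h : upper x = diag (Units.mk0 x hx) * upper 1 * (diag (Units.mk0 x hx))⁻¹ := by
    rw [diag_mul_upper, mul_inv_cancel_right]; simp
  rw [h, Representation.char_conj]

theorem character_lower_eq (x : F) : ρ.character (lower x) = ρ.character (upper x) := by
  have h : lower x = swap F * upper x * (swap F)⁻¹ := by
    rw [swap_mul_upper, mul_inv_cancel_right]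
  rw [h, Representation.char_conj]

/-- If the upper unitriangular matrices have no nonzero common fixed vector, then the character
values on them sum to zero. -/
theorem finrank_add_character_upper_eq_zero [FiniteDimensional ℂ V] [Fintype F]
    (hno : ∀ w : V, (∀ x, ρ (upper x) w = w) → w = 0) :
    (finrank ℂ V : ℂ) + (Fintype.card F - 1) * ρ.character (upper 1) = 0 := by
  classical
  have h0 : ∑ x : F, ρ (upper x) = 0 := by
    ext v
    refine hno _ fun y => ?_
    rw [LinearMap.sum_apply, map_sum]
    refine Fintype.sum_equiv (Equiv.addLeft y) _ _ fun x => ?_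
    rw [← Module.End.mul_apply, ← map_mul, ← upper_add]
    rfl
  have h1 : ∑ x : F, ρ.character (upper x) = 0 := by
    simp only [Representation.character]
    rw [← map_sum, h0, map_zero]
  rw [← Finset.add_sum_erase _ _ (Finset.mem_univ 0), upper_zero, Representation.char_one,
    Finset.sum_congr rfl fun x hx => character_upper_eq (Finset.ne_of_mem_erase hx),
    Finset.sum_const, Finset.card_erase_of_mem (Finset.mem_univ _), Finset.card_univ,
    nsmul_eq_mul, Nat.cast_sub Fintype.card_pos, Nat.cast_one] at h1
  exact h1

/-- The first orthogonality relation, in terms of absolute values. -/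
theorem sum_normSq_character [FiniteDimensional ℂ V] {G : Type*} [Group G] [Fintype G] {σ : Representation ℂ G V}
    (hσ : σ.IsIrreducible) :
    ∑ g : G, Complex.normSq (σ.character g) = Fintype.card G := by
  have hG : (Nat.card G : ℂ) ≠ 0 := by simp [Nat.card_eq_fintype_card]
  have := invertibleOfNonzero hG
  have h := Representation.char_orthonormal σ σ
  rw [if_pos ⟨Representation.Equiv.refl σ⟩, inv_mul_eq_one₀ hG] at h
  rw [Nat.card_eq_fintype_card] at h
  have hc : ∀ g : G, σ.character g * σ.character g⁻¹ = (Complex.normSq (σ.character g) : ℂ) := by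
    intro g
    have : σ.character g⁻¹ = starRingEnd ℂ (σ.character g) :=
      LinearMap.trace_eq_conj_of_pow_eq_one (n := Fintype.card G) Fintype.card_pos
        (by rw [← map_pow, pow_card_eq_one, map_one]) (by rw [← map_mul, inv_mul_cancel, map_one])
    rw [this, Complex.mul_conj]
  simp only [hc] at h
  exact_mod_cast h.symm

theorem exists_int_eq_of_isIntegral {x : ℂ} (hx : IsIntegral ℤ x) {a b : ℤ} (hb : b ≠ 0)
    (h : (a : ℂ) + b * x = 0) : ∃ n : ℤ, x = n := by
  have hb' : (b : ℂ) ≠ 0 := by exact_mod_cast hb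
  have hxr : x = algebraMap ℚ ℂ (-a / b) := by
    push_cast
    simp
    field_simp
    linear_combination h
  rw [hxr, isIntegral_algebraMap_iff (algebraMap ℚ ℂ).injective,
    IsIntegrallyClosed.isIntegral_iff] at hx
  obtain ⟨n, hn⟩ := hx
  exact ⟨n, by rw [hxr, ← hn]; simp⟩

/-- The scalar multiples of upper unitriangular and nontrivial lower unitriangular matrices. -/
def scaledUnipotent (p : Fˣ × (F ⊕ Fˣ)) : GL (Fin 2) F :=
  scal p.1 * Sum.elim upper (fun y : Fˣ => lower (y : F)) p.2

theorem scaledUnipotent_injective : Function.Injective (scaledUnipotent (F := F)) := by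
  rintro ⟨z, x | y⟩ ⟨z', x' | y'⟩ h
  all_goals
    have h00 := congrArg (fun m : GL (Fin 2) F => m.1 0 0) h
    have h01 := congrArg (fun m : GL (Fin 2) F => m.1 0 1) h
    have h10 := congrArg (fun m : GL (Fin 2) F => m.1 1 0) h
    simp [scaledUnipotent, scal, upper, lower] at h00 h01 h10
    try simp_all [Units.ext_iff]

/-- An irreducible representation of degree `q + 1` with trivial central character is not
cuspidal. -/
theorem exists_fixed_by_upper [FiniteDimensional ℂ V] [Fintype F] (hρ : ρ.IsIrreducible) (hZ : ∀ z : Fˣ, ρ (scal z) = 1)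
    (hdim : finrank ℂ V = Fintype.card F + 1) :
    ∃ w : V, w ≠ 0 ∧ ∀ x, ρ (upper x) w = w := by
  classical
  by_contra! hcon
  have hno : ∀ w : V, (∀ x, ρ (upper x) w = w) → w = 0 := by
    intro w hw
    by_contra h0
    obtain ⟨x, hx⟩ := hcon w h0
    exact hx (hw x)
  have h := finrank_add_character_upper_eq_zero hno
  have hcardG := Matrix.card_GL_field (𝔽 := F) 2
  rw [Nat.card_eq_fintype_card, Fin.prod_univ_two] at hcardG
  have hcardU : Fintype.card Fˣ = Fintype.card F - 1 := Fintype.card_units F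
  have hq2 : 2 ≤ Fintype.card F := Fintype.one_lt_card
  have hsum := sum_normSq_character hρ
  have hint : IsIntegral ℤ (ρ.character (upper 1)) :=
    LinearMap.isIntegral_trace_of_pow_eq_one (n := Fintype.card (GL (Fin 2) F)) Fintype.card_pos
      (by rw [← map_pow, pow_card_eq_one, map_one])
  obtain ⟨n, hn⟩ := exists_int_eq_of_isIntegral hint
    (a := Fintype.card F + 1) (b := Fintype.card F - 1) (by omega)
    (by rw [hdim] at h; push_cast at h ⊢; exact h)
  have hscal : ∀ (z : Fˣ) (g : GL (Fin 2) F), ρ.character (scal z * g) = ρ.character g := by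
    intro z g
    simp [Representation.character, hZ]
  have hle : ∑ p : Fˣ × (F ⊕ Fˣ), Complex.normSq (ρ.character (scaledUnipotent p)) ≤
      ∑ g : GL (Fin 2) F, Complex.normSq (ρ.character g) := by
    rw [← Finset.sum_image (f := fun g => Complex.normSq (ρ.character g))
      scaledUnipotent_injective.injOn]
    exact Finset.sum_le_sum_of_subset_of_nonneg (Finset.subset_univ _)
      fun _ _ _ => Complex.normSq_nonneg _
  have hlow : ∀ y : Fˣ, ρ.character (lower (y : F)) = n := fun y => by
    rw [character_lower_eq, character_upper_eq y.ne_zero, hn]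
  have hup : ∑ x : F, Complex.normSq (ρ.character (upper x)) =
      (Fintype.card F + 1 : ℝ) ^ 2 + (Fintype.card F - 1) * (n : ℝ) ^ 2 := by
    rw [← Finset.add_sum_erase _ _ (Finset.mem_univ 0), upper_zero, Representation.char_one, hdim,
      Finset.sum_congr rfl fun x hx => by
        rw [character_upper_eq (Finset.ne_of_mem_erase hx), hn],
      Finset.sum_const, Finset.card_erase_of_mem (Finset.mem_univ _), Finset.card_univ,
      nsmul_eq_mul, Nat.cast_sub Fintype.card_pos, Nat.cast_one, Complex.normSq_natCast,
      Complex.normSq_intCast]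
    push_cast
    ring
  rw [hsum, Fintype.sum_prod_type] at hle
  simp only [Fintype.sum_sum_type, scaledUnipotent, Sum.elim_inl, Sum.elim_inr, hscal, hlow, hup,
    Finset.sum_const, Finset.card_univ, nsmul_eq_mul, Complex.normSq_intCast, hcardU, hcardG,
    Nat.cast_sub Fintype.card_pos] at hle
  have hn' : ((Fintype.card F : ℤ) + 1) + (Fintype.card F - 1) * n = 0 := by
    rw [hdim, hn] at h
    exact_mod_cast h
  generalize Fintype.card F = q at *
  have hq : q = 2 ∨ q = 3 := by
    have hd : ((q : ℤ) - 1) ∣ 2 := ⟨-n - 1, by linear_combination hn'⟩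
    have := Int.le_of_dvd two_pos hd
    omega
  rcases hq with rfl | rfl
  · obtain rfl : n = -3 := by push_cast at hn'; omega
    norm_num at hle
  · obtain rfl : n = -2 := by push_cast at hn'; omega
    norm_num at hle

/-- Every irreducible representation of `GL₂(q)` of degree `q + 1` that is trivial on the center is
unisingular. -/
theorem hasEigenvalue_one [FiniteDimensional ℂ V] [Fintype F] (hρ : ρ.IsIrreducible)
    (hZ : ∀ z ∈ Subgroup.center (GL (Fin 2) F), ρ z = 1)
    (hdim : finrank ℂ V = Fintype.card F + 1) (g : GL (Fin 2) F) :
    Module.End.HasEigenvalue (ρ g) 1 := by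
  have hscal : ∀ z : Fˣ, ρ (scal z) = 1 := fun z => hZ _ (scal_mem_center z)
  obtain ⟨w, hw, hU⟩ := exists_fixed_by_upper hρ hscal hdim
  by_cases hg : g ∈ Subgroup.center (GL (Fin 2) F)
  · rw [hZ g hg]
    exact Module.End.hasEigenvalue_of_hasEigenvector
      ⟨Module.End.mem_eigenspace_iff.2 (one_smul ℂ w).symm, hw⟩
  · obtain ⟨v, hv, hB⟩ := exists_borel_eigenvector hscal hw hU
    obtain ⟨h, hh⟩ := exists_free_point g hg
    refine hρ.hasEigenvalue_one hv hB (hdim ▸ card_quotient_borel_le) (h := h) fun k hk => ?_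
    rw [← map_pow]
    exact hZ _ (hh k hk)

end GLTwo

/-- Let `F` be a finite field with `q` elements. Every irreducible complex
character of `PGL₂(q)` of degree `q + 1` is unisingular. -/
theorem PGL2_unisingular_of_deg_q_add_one (q : ℕ) (F : Type) [Field F] [Fintype F]
    (hF : Fintype.card F = q) (V : FDRep ℂ (PGL2 F)) (hV : Simple V)
    (hdeg : Module.finrank ℂ V = q + 1) :
    V.IsUnisingular := by
  have hρ := (FDRep.isIrreducible_of_simple V).comp_surjective
    (QuotientGroup.mk'_surjective (Subgroup.center (GL (Fin 2) F)))
  intro g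
  induction g using QuotientGroup.induction_on with | _ g => ?_
  refine GLTwo.hasEigenvalue_one hρ (fun z hz => ?_) (by rw [hdeg, hF]) g
  have hz1 : QuotientGroup.mk' (Subgroup.center (GL (Fin 2) F)) z = 1 :=
    (QuotientGroup.eq_one_iff z).2 hz
  rw [MonoidHom.comp_apply, hz1, map_one]
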